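/- arXiv:1610.06473 — 8 statements merged into one kernel-verified Lean document; each statement's English description precedes it below -/
import Mathlib

section
/- Let F : L([0,1])² → L([0,1]) be a function. Then F is migrative (i.e., F(αX, Y) = F(X, αY) for all α, X, Y ∈ L([0,1])) if and only if F(X, Y) = F([1,1], XY) for all X, Y ∈ L([0,1]). -/
/-! Closed subintervals of the unit interval, interval-valued overlap functions,
and related notions. -/

/-- The set `L([0,1])` of closed subintervals `[lo, hi]` of `[0,1]`. -/
@[ext]
structure IV : Type where
  lo : ℝ
  hi : ℝ
  lo_nonneg : 0 ≤ lo
  lo_le_hi : lo ≤ hi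
  hi_le_one : hi ≤ 1

namespace IV

/-- The degenerate interval `[0,0]`. -/
instance : Zero IV := ⟨⟨0, 0, le_refl 0, le_refl 0, zero_le_one⟩⟩

/-- The degenerate interval `[1,1]`. -/
instance : One IV := ⟨⟨1, 1, zero_le_one, le_refl 1, le_refl 1⟩⟩

/-- Interval product: `X * Y = [x̲·y̲, x̄·ȳ]`. -/
instance : Mul IV :=
  ⟨fun X Y =>
    ⟨X.lo * Y.lo, X.hi * Y.hi, mul_nonneg X.lo_nonneg Y.lo_nonneg,
      mul_le_mul X.lo_le_hi Y.lo_le_hi Y.lo_nonneg (X.lo_nonneg.trans X.lo_le_hi),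
      mul_le_one₀ X.hi_le_one (Y.lo_nonneg.trans Y.lo_le_hi) Y.hi_le_one⟩⟩

/-- The product (componentwise) order on intervals. -/
instance : LE IV := ⟨fun X Y => X.lo ≤ Y.lo ∧ X.hi ≤ Y.hi⟩

/-- Componentwise maximum of intervals: `X ∨ Y`. -/
instance : Max IV :=
  ⟨fun X Y =>
    ⟨max X.lo Y.lo, max X.hi Y.hi, le_max_of_le_left X.lo_nonneg,
      max_le_max X.lo_le_hi Y.lo_le_hi, max_le X.hi_le_one Y.hi_le_one⟩⟩

/-- Componentwise minimum of intervals: `X ∧ Y`. -/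
instance : Min IV :=
  ⟨fun X Y =>
    ⟨min X.lo Y.lo, min X.hi Y.hi, le_min X.lo_nonneg Y.lo_nonneg,
      min_le_min X.lo_le_hi Y.lo_le_hi, min_le_of_left_le X.hi_le_one⟩⟩

/-- Interval inclusion: `X ⊆ Y`. -/
def subs (X Y : IV) : Prop := Y.lo ≤ X.lo ∧ X.hi ≤ Y.hi

/-- The Moore metric on intervals. -/
noncomputable def mdist (X Y : IV) : ℝ := max |X.lo - Y.lo| |X.hi - Y.hi|

/-- Interval power with natural exponent: `Xⁿ = [x̲ⁿ, x̄ⁿ]`. -/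
def npow (X : IV) (n : ℕ) : IV :=
  ⟨X.lo ^ n, X.hi ^ n, pow_nonneg X.lo_nonneg n,
    pow_le_pow_left₀ X.lo_nonneg X.lo_le_hi n,
    pow_le_one₀ (X.lo_nonneg.trans X.lo_le_hi) X.hi_le_one⟩

/-- Interval `n`-th root: `X^{1/n} = [x̲^{1/n}, x̄^{1/n}]`. -/
noncomputable def nroot (X : IV) (n : ℕ) : IV :=
  ⟨X.lo ^ ((n : ℝ))⁻¹, X.hi ^ ((n : ℝ))⁻¹,
    Real.rpow_nonneg X.lo_nonneg _,
    Real.rpow_le_rpow X.lo_nonneg X.lo_le_hi (by positivity),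
    Real.rpow_le_one (X.lo_nonneg.trans X.lo_le_hi) X.hi_le_one (by positivity)⟩

/-- Interval complement: `Xᶜ = [1 - x̄, 1 - x̲]`. -/
def compl (X : IV) : IV :=
  ⟨1 - X.hi, 1 - X.lo, by linarith [X.hi_le_one], by linarith [X.lo_le_hi],
    by linarith [X.lo_nonneg]⟩

/-- Interval power with interval exponent `K = [k₁,k₂]`, `0 < k₁ ≤ k₂`:
`X^K = [x̲^{k₂}, x̄^{k₁}]`. -/
noncomputable def ipow (X : IV) (k₁ k₂ : ℝ) (hk₁ : 0 < k₁) (hk : k₁ ≤ k₂) : IV :=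
  ⟨X.lo ^ k₂, X.hi ^ k₁,
    Real.rpow_nonneg X.lo_nonneg _,
    by
      rcases eq_or_lt_of_le X.lo_nonneg with h | h
      · rw [← h, Real.zero_rpow (by linarith : k₂ ≠ 0)]
        exact Real.rpow_nonneg (X.lo_nonneg.trans X.lo_le_hi) _
      · calc X.lo ^ k₂ ≤ X.lo ^ k₁ :=
              Real.rpow_le_rpow_of_exponent_ge h (X.lo_le_hi.trans X.hi_le_one) hk
          _ ≤ X.hi ^ k₁ := Real.rpow_le_rpow X.lo_nonneg X.lo_le_hi hk₁.le,
    Real.rpow_le_one (X.lo_nonneg.trans X.lo_le_hi) X.hi_le_one hk₁.le⟩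

end IV

/-- The unit interval `[0,1]` of real numbers. -/
abbrev I01 := unitInterval

/-- The degenerate interval `[x,x]`. -/
def IV.diag (x : I01) : IV := ⟨x, x, x.2.1, le_refl _, x.2.2⟩

/-- The left endpoint, as an element of `[0,1]`. -/
def IV.loI (X : IV) : I01 := ⟨X.lo, X.lo_nonneg, X.lo_le_hi.trans X.hi_le_one⟩

/-- The right endpoint, as an element of `[0,1]`. -/
def IV.hiI (X : IV) : I01 := ⟨X.hi, X.lo_nonneg.trans X.lo_le_hi, X.hi_le_one⟩

/-- Moore continuity of a unary interval function. -/
def MooreCont1 (g : IV → IV) : Prop :=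
  ∀ X : IV, ∀ ε > (0 : ℝ), ∃ δ > (0 : ℝ), ∀ Y : IV,
    IV.mdist X Y < δ → IV.mdist (g X) (g Y) < ε

/-- Moore continuity of a binary interval function. -/
def MooreCont2 (O : IV → IV → IV) : Prop :=
  ∀ X Y : IV, ∀ ε > (0 : ℝ), ∃ δ > (0 : ℝ), ∀ X' Y' : IV,
    IV.mdist X X' < δ → IV.mdist Y Y' < δ → IV.mdist (O X Y) (O X' Y') < ε

/-- Interval-valued overlap function. -/
structure IVOverlap (O : IV → IV → IV) : Prop where
  comm : ∀ X Y, O X Y = O Y X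
  zero_iff : ∀ X Y, O X Y = 0 ↔ X * Y = 0
  one_iff : ∀ X Y, O X Y = 1 ↔ X * Y = 1
  mono : ∀ X Y Z, Y ≤ Z → O X Y ≤ O X Z
  cont : MooreCont2 O

/-- Migrativity of a binary interval function. -/
def Migrative (F : IV → IV → IV) : Prop := ∀ α X Y : IV, F (α * X) Y = F X (α * Y)

/-- (Real-valued) overlap function on `[0,1]`. -/
structure Overlap (G : I01 → I01 → I01) : Prop where
  comm : ∀ x y, G x y = G y x
  zero_iff : ∀ x y, G x y = 0 ↔ x * y = 0
  one_iff : ∀ x y, G x y = 1 ↔ x * y = 1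
  mono : ∀ x y z, y ≤ z → G x y ≤ G x z
  cont : Continuous (Function.uncurry G)

/-- Left projection of a binary interval function. -/
def lproj (O : IV → IV → IV) (x y : I01) : I01 := (O (IV.diag x) (IV.diag y)).loI

/-- Right projection of a binary interval function. -/
def rproj (O : IV → IV → IV) (x y : I01) : I01 := (O (IV.diag x) (IV.diag y)).hiI

/-- `O(X,Y) = [G₁(x̲,y̲), G₂(x̄,ȳ)]` for all `X, Y`. -/
def Represents (G₁ G₂ : I01 → I01 → I01) (O : IV → IV → IV) : Prop :=
  ∀ X Y : IV, (O X Y).lo = (G₁ X.loI Y.loI : ℝ) ∧ (O X Y).hi = (G₂ X.hiI Y.hiI : ℝ)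

/-- o-representability of an interval-valued overlap function. -/
def ORepresentable (O : IV → IV → IV) : Prop :=
  ∃ G₁ G₂ : I01 → I01 → I01, Overlap G₁ ∧ Overlap G₂ ∧
    (∀ x y, G₁ x y ≤ G₂ x y) ∧ Represents G₁ G₂ O

/-- Interval-valued t-norm. -/
structure IVTnorm (T : IV → IV → IV) : Prop where
  comm : ∀ X Y, T X Y = T Y X
  assoc : ∀ X Y Z, T X (T Y Z) = T (T X Y) Z
  mono : ∀ X Y Z, Y ≤ Z → T X Y ≤ T X Z
  one : ∀ X, T X 1 = X

namespace IV

protected theorem mul_comm (X Y : IV) : X * Y = Y * X :=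
  IV.ext (_root_.mul_comm X.lo Y.lo) (_root_.mul_comm X.hi Y.hi)

protected theorem mul_assoc (X Y Z : IV) : X * Y * Z = X * (Y * Z) :=
  IV.ext (_root_.mul_assoc X.lo Y.lo Z.lo) (_root_.mul_assoc X.hi Y.hi Z.hi)

protected theorem mul_one (X : IV) : X * 1 = X :=
  IV.ext (_root_.mul_one X.lo) (_root_.mul_one X.hi)

end IV

/-- `F` is migrative iff `F(X,Y) = F([1,1], XY)` for all `X, Y`. -/
theorem stmt_0 (F : IV → IV → IV) :
    Migrative F ↔ ∀ X Y : IV, F X Y = F 1 (X * Y) := by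
  constructor
  · intro h X Y
    simpa only [IV.mul_one] using h X 1 Y
  · intro h α X Y
    rw [h (α * X) Y, h X (α * Y), IV.mul_comm α X, IV.mul_assoc]
end

section
/- If O₁ and O₂ are interval-valued overlap functions, then the pointwise supremum (O₁ ∨ O₂)(X,Y) = O₁(X,Y) ∨ O₂(X,Y) and the pointwise infimum (O₁ ∧ O₂)(X,Y) = O₁(X,Y) ∧ O₂(X,Y) (where ∨ and ∧ are the componentwise maximum and minimum of interval endpoints) are also interval-valued overlap functions. -/
namespace IV

theorem eq_zero_iff_hi_le (X : IV) : X = 0 ↔ X.hi ≤ 0 := by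
  constructor
  · rintro rfl
    exact le_refl (0 : ℝ)
  · intro h
    exact IV.ext (le_antisymm (X.lo_le_hi.trans h) X.lo_nonneg)
      (le_antisymm h (X.lo_nonneg.trans X.lo_le_hi))

theorem eq_one_iff_le_lo (X : IV) : X = 1 ↔ 1 ≤ X.lo := by
  constructor
  · rintro rfl
    exact le_refl (1 : ℝ)
  · intro h
    exact IV.ext (le_antisymm (X.lo_le_hi.trans X.hi_le_one) h)
      (le_antisymm X.hi_le_one (h.trans X.lo_le_hi))

theorem max_eq_zero_iff (X Y : IV) : max X Y = 0 ↔ X = 0 ∧ Y = 0 := by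
  simp only [eq_zero_iff_hi_le]
  exact max_le_iff

theorem max_eq_one_iff (X Y : IV) : max X Y = 1 ↔ X = 1 ∨ Y = 1 := by
  simp only [eq_one_iff_le_lo]
  exact le_max_iff

theorem min_eq_zero_iff (X Y : IV) : min X Y = 0 ↔ X = 0 ∨ Y = 0 := by
  simp only [eq_zero_iff_hi_le]
  exact min_le_iff

theorem min_eq_one_iff (X Y : IV) : min X Y = 1 ↔ X = 1 ∧ Y = 1 := by
  simp only [eq_one_iff_le_lo]
  exact le_min_iff

theorem max_mono {X X' Y Y' : IV} (hX : X ≤ X') (hY : Y ≤ Y') : max X Y ≤ max X' Y' :=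
  ⟨max_le_max hX.1 hY.1, max_le_max hX.2 hY.2⟩

theorem min_mono {X X' Y Y' : IV} (hX : X ≤ X') (hY : Y ≤ Y') : min X Y ≤ min X' Y' :=
  ⟨min_le_min hX.1 hY.1, min_le_min hX.2 hY.2⟩

theorem mdist_max_lt {X X' Y Y' : IV} {ε : ℝ} (hX : mdist X X' < ε) (hY : mdist Y Y' < ε) :
    mdist (max X Y) (max X' Y') < ε := by
  rw [mdist, max_lt_iff] at hX hY
  exact max_lt ((abs_max_sub_max_le_max _ _ _ _).trans_lt (max_lt hX.1 hY.1))
    ((abs_max_sub_max_le_max _ _ _ _).trans_lt (max_lt hX.2 hY.2))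

theorem mdist_min_lt {X X' Y Y' : IV} {ε : ℝ} (hX : mdist X X' < ε) (hY : mdist Y Y' < ε) :
    mdist (min X Y) (min X' Y') < ε := by
  rw [mdist, max_lt_iff] at hX hY
  exact max_lt ((abs_min_sub_min_le_max _ _ _ _).trans_lt (max_lt hX.1 hY.1))
    ((abs_min_sub_min_le_max _ _ _ _).trans_lt (max_lt hX.2 hY.2))

end IV

/-- A pointwise combination of two Moore continuous functions is Moore continuous whenever the
combining operation does not increase the Moore distance. -/
theorem MooreCont2.map₂ {O₁ O₂ : IV → IV → IV} (h₁ : MooreCont2 O₁) (h₂ : MooreCont2 O₂)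
    (f : IV → IV → IV)
    (hf : ∀ {X X' Y Y' : IV} {ε : ℝ}, IV.mdist X X' < ε → IV.mdist Y Y' < ε →
      IV.mdist (f X Y) (f X' Y') < ε) :
    MooreCont2 (fun X Y => f (O₁ X Y) (O₂ X Y)) := by
  intro X Y ε hε
  obtain ⟨δ₁, hδ₁, H₁⟩ := h₁ X Y ε hε
  obtain ⟨δ₂, hδ₂, H₂⟩ := h₂ X Y ε hε
  refine ⟨min δ₁ δ₂, lt_min hδ₁ hδ₂, fun X' Y' hX hY => ?_⟩
  rw [lt_min_iff] at hX hY
  exact hf (H₁ X' Y' hX.1 hY.1) (H₂ X' Y' hX.2 hY.2)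

theorem IVOverlap.max {O₁ O₂ : IV → IV → IV} (h₁ : IVOverlap O₁) (h₂ : IVOverlap O₂) :
    IVOverlap (fun X Y => Max.max (O₁ X Y) (O₂ X Y)) where
  comm X Y := by simp only [h₁.comm X Y, h₂.comm X Y]
  zero_iff X Y := by rw [IV.max_eq_zero_iff, h₁.zero_iff, h₂.zero_iff, and_self_iff]
  one_iff X Y := by rw [IV.max_eq_one_iff, h₁.one_iff, h₂.one_iff, or_self_iff]
  mono X Y Z h := IV.max_mono (h₁.mono X Y Z h) (h₂.mono X Y Z h)
  cont := h₁.cont.map₂ h₂.cont Max.max IV.mdist_max_lt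

theorem IVOverlap.min {O₁ O₂ : IV → IV → IV} (h₁ : IVOverlap O₁) (h₂ : IVOverlap O₂) :
    IVOverlap (fun X Y => Min.min (O₁ X Y) (O₂ X Y)) where
  comm X Y := by simp only [h₁.comm X Y, h₂.comm X Y]
  zero_iff X Y := by rw [IV.min_eq_zero_iff, h₁.zero_iff, h₂.zero_iff, or_self_iff]
  one_iff X Y := by rw [IV.min_eq_one_iff, h₁.one_iff, h₂.one_iff, and_self_iff]
  mono X Y Z h := IV.min_mono (h₁.mono X Y Z h) (h₂.mono X Y Z h)
  cont := h₁.cont.map₂ h₂.cont Min.min IV.mdist_min_lt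

/-- the pointwise supremum and infimum of two interval-valued
overlap functions are interval-valued overlap functions. -/
theorem stmt_2 (O₁ O₂ : IV → IV → IV) (h₁ : IVOverlap O₁) (h₂ : IVOverlap O₂) :
    IVOverlap (fun X Y => max (O₁ X Y) (O₂ X Y)) ∧
    IVOverlap (fun X Y => min (O₁ X Y) (O₂ X Y)) :=
  ⟨h₁.max h₂, h₁.min h₂⟩
end

section
/- Let G₁ and G₂ be overlap functions on [0,1] such that G₁(x,y) ≤ G₂(x,y) for all x, y ∈ [0,1]. Then the function O : L([0,1])² → L([0,1]) defined by O(X,Y) = [G₁(x̲, y̲), G₂(x̄, ȳ)] is an interval-valued overlap function. -/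
/-- The coordinates of an overlap function satisfy the `ε`-`δ` form of joint continuity. -/
theorem Overlap.exists_delta {G : I01 → I01 → I01} (h : Overlap G) (x y : I01) {ε : ℝ}
    (hε : 0 < ε) : ∃ δ > (0 : ℝ), ∀ x' y' : I01, |(x : ℝ) - x'| < δ → |(y : ℝ) - y'| < δ →
      |(G x y : ℝ) - G x' y'| < ε := by
  obtain ⟨δ, hδ, H⟩ := Metric.continuous_iff.1 h.cont (x, y) ε hε
  refine ⟨δ, hδ, fun x' y' hx hy => ?_⟩
  have key := H (x', y') (by
    rw [Prod.dist_eq, max_lt_iff, Subtype.dist_eq, Subtype.dist_eq, Real.dist_eq, Real.dist_eq,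
      abs_sub_comm, abs_sub_comm (y' : ℝ)]
    exact ⟨hx, hy⟩)
  rw [Subtype.dist_eq, Real.dist_eq, abs_sub_comm] at key
  exact key

theorem IV.eq_zero_iff (X : IV) : X = 0 ↔ X.loI = 0 ∧ X.hiI = 0 := by
  rw [IV.ext_iff, Subtype.ext_iff, Subtype.ext_iff]
  rfl

theorem IV.eq_one_iff (X : IV) : X = 1 ↔ X.loI = 1 ∧ X.hiI = 1 := by
  rw [IV.ext_iff, Subtype.ext_iff, Subtype.ext_iff]
  rfl

theorem IV.loI_mul (X Y : IV) : (X * Y).loI = X.loI * Y.loI := rfl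

theorem IV.hiI_mul (X Y : IV) : (X * Y).hiI = X.hiI * Y.hiI := rfl

/-- if `G₁ ≤ G₂` are overlap functions on `[0,1]`, then
`O(X,Y) = [G₁(x̲,y̲), G₂(x̄,ȳ)]` is an interval-valued overlap function. -/
theorem stmt_5 (G₁ G₂ : I01 → I01 → I01) (h₁ : Overlap G₁) (h₂ : Overlap G₂)
    (hle : ∀ x y, G₁ x y ≤ G₂ x y) (O : IV → IV → IV)
    (hO : Represents G₁ G₂ O) : IVOverlap O := by
  have hlo : ∀ X Y, (O X Y).loI = G₁ X.loI Y.loI := fun X Y => Subtype.ext (hO X Y).1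
  have hhi : ∀ X Y, (O X Y).hiI = G₂ X.hiI Y.hiI := fun X Y => Subtype.ext (hO X Y).2
  refine ⟨fun X Y => ?_, fun X Y => ?_, fun X Y => ?_, fun X Y Z hYZ => ?_, fun X Y ε hε => ?_⟩
  · apply IV.ext
    · rw [(hO X Y).1, (hO Y X).1, h₁.comm]
    · rw [(hO X Y).2, (hO Y X).2, h₂.comm]
  · rw [IV.eq_zero_iff, IV.eq_zero_iff, hlo, hhi, h₁.zero_iff, h₂.zero_iff, IV.loI_mul,
      IV.hiI_mul]
  · rw [IV.eq_one_iff, IV.eq_one_iff, hlo, hhi, h₁.one_iff, h₂.one_iff, IV.loI_mul,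
      IV.hiI_mul]
  · constructor
    · rw [(hO X Y).1, (hO X Z).1]
      exact h₁.mono X.loI Y.loI Z.loI hYZ.1
    · rw [(hO X Y).2, (hO X Z).2]
      exact h₂.mono X.hiI Y.hiI Z.hiI hYZ.2
  · obtain ⟨δ₁, hδ₁, H₁⟩ := h₁.exists_delta X.loI Y.loI hε
    obtain ⟨δ₂, hδ₂, H₂⟩ := h₂.exists_delta X.hiI Y.hiI hε
    refine ⟨min δ₁ δ₂, lt_min hδ₁ hδ₂, fun X' Y' hX hY => ?_⟩
    obtain ⟨hXlo, hXhi⟩ := max_lt_iff.1 hX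
    obtain ⟨hYlo, hYhi⟩ := max_lt_iff.1 hY
    rw [IV.mdist, (hO X Y).1, (hO X Y).2, (hO X' Y').1, (hO X' Y').2]
    exact max_lt
      (H₁ X'.loI Y'.loI (hXlo.trans_le (min_le_left _ _)) (hYlo.trans_le (min_le_left _ _)))
      (H₂ X'.hiI Y'.hiI (hXhi.trans_le (min_le_right _ _)) (hYhi.trans_le (min_le_right _ _)))
end

section
/- Let F : L([0,1])ⁿ → L([0,1]) be monotone with respect to the componentwise product order. Then F(X₁,…,Xₙ) = [F̲(x̲₁,…,x̲ₙ), F̄(x̄₁,…,x̄ₙ)] for all X₁,…,Xₙ ∈ L([0,1]) (where F̲ and F̄ are the left and right endpoint functions of F evaluated at degenerate intervals) if and only if F is inclusion monotonic, i.e., Xᵢ ⊆ Yᵢ for all i implies F(X₁,…,Xₙ) ⊆ F(Y₁,…,Yₙ). -/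
/-- a monotone `F : L([0,1])ⁿ → L([0,1])` satisfies
`F(X₁,…,Xₙ) = [F̲(x̲₁,…,x̲ₙ), F̄(x̄₁,…,x̄ₙ)]` iff it is inclusion monotonic. -/
theorem stmt_8 (n : ℕ) (F : (Fin n → IV) → IV)
    (hmono : ∀ X Y : Fin n → IV, (∀ i, X i ≤ Y i) → F X ≤ F Y) :
    (∀ X : Fin n → IV,
        (F X).lo = (F fun i => IV.diag (X i).loI).lo ∧
        (F X).hi = (F fun i => IV.diag (X i).hiI).hi) ↔
    (∀ X Y : Fin n → IV, (∀ i, (X i).subs (Y i)) → (F X).subs (F Y)) := by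
  constructor
  · intro h X Y hXY
    constructor
    · rw [(h X).1, (h Y).1]
      exact (hmono (fun i => IV.diag (Y i).loI) (fun i => IV.diag (X i).loI)
        fun i => ⟨(hXY i).1, (hXY i).1⟩).1
    · rw [(h X).2, (h Y).2]
      exact (hmono (fun i => IV.diag (X i).hiI) (fun i => IV.diag (Y i).hiI)
        fun i => ⟨(hXY i).2, (hXY i).2⟩).2
  · intro h X
    constructor
    · exact le_antisymm
        (h (fun i => IV.diag (X i).loI) X fun i => ⟨le_rfl, (X i).lo_le_hi⟩).1
        (hmono (fun i => IV.diag (X i).loI) X fun i => ⟨le_rfl, (X i).lo_le_hi⟩).1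
    · exact le_antisymm
        (hmono X (fun i => IV.diag (X i).hiI) fun i => ⟨(X i).lo_le_hi, le_rfl⟩).2
        (h (fun i => IV.diag (X i).hiI) X fun i => ⟨(X i).lo_le_hi, le_rfl⟩).2
end

section
/- If a function F : L([0,1])² → L([0,1]) satisfies property (O2) (F(X,Y) = [0,0] iff XY = [0,0]), then F does not satisfy the self-duality property: there exist X, Y ∈ L([0,1]) such that F(X,Y) ≠ (F(Xᶜ, Yᶜ))ᶜ, where Xᶜ = [1 − x̄, 1 − x̲]. -/
/-- a function satisfying property (O2) is not self-dual. -/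
theorem stmt_10 (F : IV → IV → IV) (h : ∀ X Y : IV, F X Y = 0 ↔ X * Y = 0) :
    ∃ X Y : IV, F X Y ≠ (F X.compl Y.compl).compl := by
  by_contra! hdual
  have zero_compl : (0 : IV).compl = 1 := IV.ext (sub_zero 1) (sub_zero 1)
  have one_compl : (1 : IV).compl = 0 := IV.ext (sub_self 1) (sub_self 1)
  have h01 : F 0 1 = 0 := (h 0 1).2 (IV.ext (zero_mul 1) (zero_mul 1))
  have h10 : F 1 0 = 0 := (h 1 0).2 (IV.ext (mul_zero 1) (mul_zero 1))
  have key := hdual 0 1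
  rw [zero_compl, one_compl, h01, h10, zero_compl] at key
  exact zero_ne_one (α := ℝ) (congrArg IV.lo key)
end

section
/- If F : L([0,1])² → L([0,1]) is migrative and idempotent (F(X,X) = X for all X), then F is homogeneous of order [1,1], i.e., F(αX, αY) = α·F(X,Y) for all α, X, Y ∈ L([0,1]). -/
namespace IV

protected theorem one_mul (X : IV) : 1 * X = X :=
  IV.ext (_root_.one_mul X.lo) (_root_.one_mul X.hi)

protected theorem mul_mul_mul_comm (X Y Z W : IV) : (X * Y) * (Z * W) = (X * Z) * (Y * W) :=
  IV.ext (_root_.mul_mul_mul_comm X.lo Y.lo Z.lo W.lo)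
    (_root_.mul_mul_mul_comm X.hi Y.hi Z.hi W.hi)

theorem exists_mul_self_eq (X : IV) : ∃ S : IV, S * S = X :=
  ⟨⟨√X.lo, √X.hi, Real.sqrt_nonneg _, Real.sqrt_le_sqrt X.lo_le_hi,
      Real.sqrt_le_one.mpr X.hi_le_one⟩,
    IV.ext (Real.mul_self_sqrt X.lo_nonneg)
      (Real.mul_self_sqrt (X.lo_nonneg.trans X.lo_le_hi))⟩

theorem mul_self_injective {X Y : IV} (h : X * X = Y * Y) : X = Y :=
  IV.ext ((mul_self_inj X.lo_nonneg Y.lo_nonneg).mp (congrArg IV.lo h))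
    ((mul_self_inj (X.lo_nonneg.trans X.lo_le_hi) (Y.lo_nonneg.trans Y.lo_le_hi)).mp
      (congrArg IV.hi h))

end IV

/-- A migrative function depends only on the product of its arguments. -/
theorem Migrative.eq_one_mul {F : IV → IV → IV} (hmig : Migrative F) (X Y : IV) :
    F X Y = F 1 (X * Y) := by
  rw [← hmig X 1 Y, IV.mul_comm, IV.one_mul]

/-- A migrative idempotent function is the geometric mean. -/
theorem Migrative.mul_self_eq {F : IV → IV → IV} (hmig : Migrative F)
    (hid : ∀ X : IV, F X X = X) (X Y : IV) : F X Y * F X Y = X * Y := by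
  obtain ⟨S, hS⟩ := IV.exists_mul_self_eq (X * Y)
  rw [hmig.eq_one_mul X Y, ← hS, ← hmig.eq_one_mul S S, hid]

/-- a migrative and idempotent interval function is homogeneous
of order `[1,1]`. -/
theorem stmt_11 (F : IV → IV → IV) (hmig : Migrative F)
    (hid : ∀ X : IV, F X X = X) :
    ∀ α X Y : IV, F (α * X) (α * Y) = α * F X Y := by
  intro α X Y
  apply IV.mul_self_injective
  rw [hmig.mul_self_eq hid, IV.mul_mul_mul_comm α (F X Y), hmig.mul_self_eq hid,
    IV.mul_mul_mul_comm α X]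
end

section
/- If F : L([0,1])² → L([0,1]) is migrative and has [1,1] as neutral element (F([1,1], X) = X for all X), then F is homogeneous of order [2,2], i.e., F(αX, αY) = α²·F(X,Y) for all α, X, Y ∈ L([0,1]), where α² = [α̲², ᾱ²]. -/
/-- Intervals in `L([0,1])` form a commutative monoid under the interval product. -/
instance : CommMonoid IV where
  mul_assoc X Y Z := IV.ext (mul_assoc X.lo Y.lo Z.lo) (mul_assoc X.hi Y.hi Z.hi)
  mul_comm X Y := IV.ext (mul_comm X.lo Y.lo) (mul_comm X.hi Y.hi)
  one_mul X := IV.ext (one_mul X.lo) (one_mul X.hi)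
  mul_one X := IV.ext (mul_one X.lo) (mul_one X.hi)

/-- A migrative function with left neutral element `[1,1]` is the interval product. -/
theorem Migrative.eq_mul {F : IV → IV → IV} (hmig : Migrative F)
    (hneut : ∀ X : IV, F 1 X = X) (X Y : IV) : F X Y = X * Y := by
  simpa only [mul_one, hneut] using hmig X 1 Y

/-- a migrative interval function with neutral element `[1,1]`
is homogeneous of order `[2,2]`. -/
theorem stmt_12 (F : IV → IV → IV) (hmig : Migrative F)
    (hneut : ∀ X : IV, F 1 X = X) :
    ∀ α X Y : IV, F (α * X) (α * Y) = α * α * F X Y := by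
  intro α X Y
  rw [hmig.eq_mul hneut, hmig.eq_mul hneut]
  exact mul_mul_mul_comm α X α Y
end

section
/- Let O be an associative interval-valued overlap function and let g_O(X) = O(X, [1,1]). If g_O is surjective or inclusion monotonic (X ⊆ Y implies g_O(X) ⊆ g_O(Y)), then [1,1] is a neutral element of O (O(X, [1,1]) = X for all X), so that O is an interval-valued t-norm. -/
namespace IV

theorem lo_eq_of_monotone {g : IV → IV} (hm : ∀ X Y : IV, X ≤ Y → g X ≤ g Y)
    (hs : ∀ X Y : IV, X.subs Y → (g X).subs (g Y)) {X Y : IV} (h : X.lo = Y.lo) :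
    (g X).lo = (g Y).lo := by
  rcases le_total X.hi Y.hi with h' | h'
  · exact le_antisymm (hm X Y ⟨h.le, h'⟩).1 (hs X Y ⟨h.ge, h'⟩).1
  · exact le_antisymm (hs Y X ⟨h.le, h'⟩).1 (hm Y X ⟨h.ge, h'⟩).1

theorem hi_eq_of_monotone {g : IV → IV} (hm : ∀ X Y : IV, X ≤ Y → g X ≤ g Y)
    (hs : ∀ X Y : IV, X.subs Y → (g X).subs (g Y)) {X Y : IV} (h : X.hi = Y.hi) :
    (g X).hi = (g Y).hi := by
  rcases le_total X.lo Y.lo with h' | h'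
  · exact le_antisymm (hm X Y ⟨h', h.le⟩).2 (hs Y X ⟨h', h.ge⟩).2
  · exact le_antisymm (hs X Y ⟨h', h.le⟩).2 (hm Y X ⟨h', h.ge⟩).2

theorem mdist_diag (x y : I01) : mdist (diag x) (diag y) = dist x y :=
  max_self _

theorem diag_zero : diag 0 = 0 := rfl

theorem diag_one : diag 1 = 1 := rfl

end IV

theorem MooreCont1.continuous_lo_diag {g : IV → IV} (hg : MooreCont1 g) :
    Continuous fun x : I01 => (g (IV.diag x)).lo := by
  refine Metric.continuous_iff'.2 fun x ε hε => ?_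
  obtain ⟨δ, hδ, h⟩ := hg (IV.diag x) ε hε
  filter_upwards [Metric.ball_mem_nhds x hδ] with y hy
  rw [dist_comm]
  refine (le_max_left _ _).trans_lt (h (IV.diag y) ?_)
  rwa [IV.mdist_diag, dist_comm]

theorem MooreCont1.continuous_hi_diag {g : IV → IV} (hg : MooreCont1 g) :
    Continuous fun x : I01 => (g (IV.diag x)).hi := by
  refine Metric.continuous_iff'.2 fun x ε hε => ?_
  obtain ⟨δ, hδ, h⟩ := hg (IV.diag x) ε hε
  filter_upwards [Metric.ball_mem_nhds x hδ] with y hy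
  rw [dist_comm]
  refine (le_max_right _ _).trans_lt (h (IV.diag y) ?_)
  rwa [IV.mdist_diag, dist_comm]

/-- A continuous idempotent self-map of `L([0,1])` that fixes `[0,0]` and `[1,1]` and is monotone
for both the product order and inclusion is the identity. -/
theorem IV.eq_self_of_idempotent {g : IV → IV} (hm : ∀ X Y : IV, X ≤ Y → g X ≤ g Y)
    (hs : ∀ X Y : IV, X.subs Y → (g X).subs (g Y)) (hc : MooreCont1 g)
    (hi : ∀ X, g (g X) = g X) (h0 : g 0 = 0) (h1 : g 1 = 1) (X : IV) : g X = X := by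
  have hlo := intermediate_value_univ (0 : I01) 1 hc.continuous_lo_diag
  have hhi := intermediate_value_univ (0 : I01) 1 hc.continuous_hi_diag
  simp only [diag_zero, diag_one, h0, h1] at hlo hhi
  obtain ⟨s, hs'⟩ := hlo ⟨X.lo_nonneg, X.lo_le_hi.trans X.hi_le_one⟩
  obtain ⟨t, ht⟩ := hhi ⟨X.lo_nonneg.trans X.lo_le_hi, X.hi_le_one⟩
  ext
  · rw [← lo_eq_of_monotone hm hs hs', hi]
    exact hs'
  · rw [← hi_eq_of_monotone hm hs ht, hi]
    exact ht

theorem IVOverlap.mooreCont1_apply_one {O : IV → IV → IV} (hO : IVOverlap O) :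
    MooreCont1 fun X => O X 1 := by
  intro X ε hε
  obtain ⟨δ, hδ, h⟩ := hO.cont X 1 ε hε
  exact ⟨δ, hδ, fun Y hY => h Y 1 hY (by simpa [IV.mdist] using hδ)⟩

/-- if `O` is an associative interval-valued overlap function and
`g_O` is surjective or inclusion monotonic, then `[1,1]` is a neutral element
of `O`, so `O` is an interval-valued t-norm. -/
theorem stmt_19 (O : IV → IV → IV) (hO : IVOverlap O)
    (hassoc : ∀ X Y Z : IV, O X (O Y Z) = O (O X Y) Z)
    (h : Function.Surjective (fun X => O X 1) ∨
        ∀ X Y : IV, X.subs Y → (O X 1).subs (O Y 1)) :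
    (∀ X : IV, O X 1 = X) ∧ IVTnorm O := by
  have h0 : O 0 1 = 0 := (hO.zero_iff 0 1).2 (IV.ext (zero_mul _) (zero_mul _))
  have h1 : O 1 1 = 1 := (hO.one_iff 1 1).2 (IV.ext (one_mul _) (one_mul _))
  have hidem : ∀ X, O (O X 1) 1 = O X 1 := fun X => by rw [← hassoc, h1]
  have key : ∀ X, O X 1 = X := by
    rcases h with h | h
    · intro X
      obtain ⟨Y, rfl⟩ := h X
      exact hidem Y
    · refine IV.eq_self_of_idempotent (g := fun X => O X 1) (fun X Y hXY => ?_) h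
        hO.mooreCont1_apply_one hidem h0 h1
      simpa only [hO.comm _ 1] using hO.mono 1 X Y hXY
  exact ⟨key, hO.comm, hassoc, hO.mono, key⟩
end
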